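/- arXiv:1207.2485 — 3 statements merged into one kernel-verified Lean document; each statement's English description precedes it below -/
import Mathlib

section
/- Let v > 1 be a real number and let p be the positive integer with 2^(p-1) < v ≤ 2^p. Define φ(x) = 2x − v·x² and set x̂₀ = 2^(−p). Suppose for i = 1,…,s the perturbed Newton iterates satisfy x̂ᵢ = φ(x̂_{i−1}) + ξᵢ with |ξᵢ| ≤ 2^(−b) and x̂ᵢ ∈ [2^(−p), 1/v]. Then for any ε_N with ε_N ≥ 2^(−2^s) (equivalently s ≥ ⌈log₂ log₂ ε_N^(−1)⌉), the final iterate satisfies |x̂ₛ − 1/v| ≤ ε_N + s·2^(−b). -/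
open Real

/-- On `[0, 1/2]` squaring does not expand upper deviations. -/
theorem sq_le_sq_add_of_le_add {d w t : ℝ} (hd : 0 ≤ d) (hd2 : d ≤ 1 / 2)
    (hw2 : w ≤ 1 / 2) (ht : 0 ≤ t) (h : d ≤ w + t) : d ^ 2 ≤ w ^ 2 + t := by
  rcases le_total d w with hdw | hdw
  · nlinarith
  · nlinarith [mul_nonneg (sub_nonneg.2 hdw) (by linarith : 0 ≤ 1 - (d + w))]

/-- Perturbed Newton iteration for the reciprocal `1/v`, `v > 1`:
with initial value `x̂₀ = 2^(-p)` (`2^(p-1) < v ≤ 2^p`), iteration map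
`φ(x) = 2x - v x²`, per-step perturbations `|ξᵢ| ≤ 2^(-b)` and all iterates
staying in `[2^(-p), 1/v]`, the final error satisfies
`|x̂ₛ - 1/v| ≤ ε_N + s·2^(-b)` whenever `ε_N ≥ 2^(-2^s)`. -/
theorem newton_fixed_precision_error
    (v : ℝ) (hv : 1 < v) (p : ℕ) (hp : 1 ≤ p)
    (hpv : (2:ℝ)^(p-1) < v) (hvp : v ≤ (2:ℝ)^p)
    (b s : ℕ) (xh ξ : ℕ → ℝ)
    (hx0 : xh 0 = (2:ℝ)^(-(p:ℤ)))
    (hstep : ∀ i, 1 ≤ i → i ≤ s →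
      xh i = (2 * xh (i-1) - v * (xh (i-1))^2) + ξ i)
    (hξ : ∀ i, 1 ≤ i → i ≤ s → |ξ i| ≤ (2:ℝ)^(-(b:ℤ)))
    (hmem : ∀ i, 1 ≤ i → i ≤ s → xh i ∈ Set.Icc ((2:ℝ)^(-(p:ℤ))) (1/v))
    (εN : ℝ) (hεN : (2:ℝ)^(-(2^s : ℤ)) ≤ εN) :
    |xh s - 1/v| ≤ εN + s * (2:ℝ)^(-(b:ℤ)) := by
  set δ : ℝ := (2:ℝ)^(-(b:ℤ))
  have hδ : 0 ≤ δ := by positivity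
  have hv0 : 0 < v := by linarith
  have hlow : 1 / 2 ≤ v * (2:ℝ)^(-(p:ℤ)) := by
    obtain ⟨q, rfl⟩ : ∃ q, p = q + 1 := ⟨p - 1, by omega⟩
    rw [Nat.add_sub_cancel] at hpv
    rw [zpow_neg, zpow_natCast, ← div_eq_mul_inv, le_div_iff₀ (by positivity), pow_succ]
    linarith
  have hup : v * (2:ℝ)^(-(p:ℤ)) ≤ 1 := by
    rw [zpow_neg, zpow_natCast, ← div_eq_mul_inv, div_le_one (by positivity)]
    exact hvp
  have hrange : ∀ i ≤ s, 0 ≤ 1 - v * xh i ∧ 1 - v * xh i ≤ 1 / 2 := by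
    intro i hi
    rcases Nat.eq_zero_or_pos i with rfl | hpos
    · rw [hx0]
      constructor <;> linarith
    · obtain ⟨h1, h2⟩ := hmem i hpos hi
      rw [le_div_iff₀ hv0] at h2
      have h3 := mul_le_mul_of_nonneg_left h1 hv0.le
      constructor <;> linarith
  have hscaled : ∀ i ≤ s, 1 - v * xh i ≤ (1 / 2 : ℝ) ^ 2 ^ i + i * (v * δ) := by
    intro i
    induction i with
    | zero => intro hi; simpa using (hrange 0 hi).2
    | succ k ih =>
      intro hk
      obtain ⟨h0, h1⟩ := hrange k (by omega)
      have hw : (1 / 2 : ℝ) ^ 2 ^ k ≤ 1 / 2 :=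
        pow_le_of_le_one (by norm_num) (by norm_num) (by positivity)
      have hsq := sq_le_sq_add_of_le_add h0 h1 hw (by positivity) (ih (by omega))
      have hst := hstep (k + 1) (by omega) hk
      have hx := mul_le_mul_of_nonneg_left (abs_le.1 (hξ (k + 1) (by omega) hk)).1 hv0.le
      rw [Nat.add_sub_cancel] at hst
      rw [hst, pow_succ 2 k, pow_mul]
      push_cast
      linarith
  have hε : (1 / 2 : ℝ) ^ 2 ^ s ≤ εN := by
    convert hεN using 1
    rw [zpow_neg, one_div, inv_pow]
    congr 1
  obtain ⟨h0, -⟩ := hrange s le_rfl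
  have herr : |xh s - 1 / v| = (1 - v * xh s) / v := by
    rw [abs_sub_comm, show 1 / v - xh s = (1 - v * xh s) / v by field_simp]
    exact abs_of_nonneg (div_nonneg h0 hv0.le)
  have hε0 : 0 ≤ εN := le_trans (by positivity) hε
  rw [herr, div_le_iff₀ hv0]
  nlinarith [hscaled s le_rfl, mul_nonneg hε0 (sub_nonneg.2 hv.le)]
end

section
/- Let r ≥ 1 be an integer, let x be a real number with 0 < x ≤ π/2, and set W = 1 + i·(x/r) − (x/r)². Then for every integer k with 1 ≤ k ≤ r, the k-th term of the binomial error expansion satisfies C(r,k)·|W|^{r−k}·(x/r)^{3k} ≤ (π/2)·e^π·(x/r)^{2k}, where C(r,k) denotes the binomial coefficient. -/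
open Real

theorem norm_one_add_I_mul_sub_sq_le_one {t : ℝ} (ht : |t| ≤ 1) :
    ‖(1 + Complex.I * t - (t : ℂ) ^ 2)‖ ≤ 1 := by
  have h : (1 + Complex.I * t - (t : ℂ) ^ 2) = ((1 - t ^ 2 : ℝ) : ℂ) + (t : ℝ) * Complex.I := by
    push_cast
    ring
  rw [h, Complex.norm_add_mul_I, Real.sqrt_le_one]
  nlinarith [(sq_le_one_iff_abs_le_one t).2 ht, sq_nonneg t]

theorem choose_mul_div_pow_le_exp {r : ℕ} (hr : 1 ≤ r) {x : ℝ} (hx : 0 ≤ x) (k : ℕ) :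
    (r.choose k : ℝ) * (x / r) ^ k ≤ Real.exp x := by
  have hr' : (0 : ℝ) < r := by exact_mod_cast hr
  calc (r.choose k : ℝ) * (x / r) ^ k
      ≤ (r : ℝ) ^ k / k.factorial * (x / r) ^ k := by
        gcongr
        exact Nat.choose_le_pow_div k r
    _ = x ^ k / k.factorial := by
        rw [div_pow]
        field_simp
    _ ≤ Real.exp x := Real.pow_div_factorial_le_exp x hx k

/-- For `0 < x ≤ π/2`, `r ≥ 1` and `W = 1 + i(x/r) - (x/r)²`, the `k`-th term of
the binomial error expansion of `(W + E(x/r))^r` satisfies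
`C(r,k)·|W|^{r-k}·(x/r)^{3k} ≤ (π/2)·e^π·(x/r)^{2k}` for all `1 ≤ k ≤ r`. -/
theorem binomial_error_term_bound (r : ℕ) (hr : 1 ≤ r) (x : ℝ)
    (hx0 : 0 < x) (hx1 : x ≤ π / 2) :
    ∀ k : ℕ, 1 ≤ k → k ≤ r →
      (r.choose k : ℝ) *
          ‖(1 + Complex.I * (x / r : ℝ) - ((x / r : ℝ) : ℂ)^2)‖^(r - k) *
          (x / r)^(3*k)
        ≤ (π / 2) * Real.exp π * (x / r)^(2*k) := by
  intro k hk1 hkr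
  have hr' : (0 : ℝ) < r := by exact_mod_cast hr
  have ht0 : 0 < x / r := by positivity
  have hpi : 1 ≤ π / 2 := Real.one_le_pi_div_two
  rw [show 3 * k = k + 2 * k by ring, pow_add, ← mul_assoc]
  refine mul_le_mul_of_nonneg_right ?_ (by positivity)
  rcases le_or_gt (x / r) 1 with ht | ht
  · have hW : ‖(1 + Complex.I * (x / r : ℝ) - ((x / r : ℝ) : ℂ) ^ 2)‖ ^ (r - k) ≤ 1 :=
      pow_le_one₀ (norm_nonneg _)
        (norm_one_add_I_mul_sub_sq_le_one (by rwa [abs_of_pos ht0]))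
    calc _ ≤ (r.choose k : ℝ) * 1 * (x / r) ^ k := by gcongr
      _ ≤ Real.exp x := by
        rw [mul_one]
        exact choose_mul_div_pow_le_exp hr hx0.le k
      _ ≤ Real.exp π := Real.exp_le_exp.2 (by linarith)
      _ ≤ π / 2 * Real.exp π := le_mul_of_one_le_left (Real.exp_nonneg _) hpi
  · rw [one_lt_div hr'] at ht
    have hr2 : (r : ℝ) < 2 := by linarith [Real.pi_lt_four]
    obtain rfl : r = 1 := le_antisymm (Nat.lt_succ_iff.1 (by exact_mod_cast hr2)) hr
    obtain rfl : k = 1 := le_antisymm hkr hk1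
    have hexp : 1 ≤ Real.exp π := Real.one_le_exp Real.pi_nonneg
    simp only [Nat.choose_self, Nat.cast_one, Nat.sub_self, pow_zero, pow_one, one_mul, div_one]
    exact hx1.trans (le_mul_of_one_le_right (by positivity) hexp)
end

section
/- Fix integers ν ≥ 1, m ≥ 1, set M = 2^m and r = 2^{ν+7}, and let s be an integer with s ≥ 11 + ν + m. Let x be a real number with π/(2M) ≤ x < π/2, set y = x/r and W = 1 − y² + i·y. Let ŷ be a real number with 0 ≤ y − ŷ ≤ 2^{−s}, and let Ŵ₁ be a complex number with |Re(Ŵ₁ − (1 − ŷ² + i·ŷ))| ≤ 2^{−s}, |Im(Ŵ₁ − (1 − ŷ² + i·ŷ))| ≤ 2^{−s} and |Ŵ₁| ≤ |1 − ŷ² + i·ŷ|. For j = 0, 1, …, ν+6 let Ŵ_{2^{j+1}} be a complex number obtained from squaring with truncation, i.e. |Re(Ŵ_{2^{j+1}} − Ŵ_{2^j}²)| ≤ 2^{−s}, |Im(Ŵ_{2^{j+1}} − Ŵ_{2^j}²)| ≤ 2^{−s} and |Ŵ_{2^{j+1}}| ≤ |Ŵ_{2^j}|². Then |W^r − Ŵ_r|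 ≤ 2^{ν+9} / 2^s. -/
open Real

/-- A complex number whose real and imaginary parts are bounded by `δ` has modulus at most
`1.42 * δ`. -/
lemma Complex.norm_le_of_abs_re_le_of_abs_im_le {z : ℂ} {δ : ℝ} (hre : |z.re| ≤ δ)
    (him : |z.im| ≤ δ) : ‖z‖ ≤ 1.42 * δ := by
  have hδ : 0 ≤ δ := (abs_nonneg _).trans hre
  refine abs_le_of_sq_le_sq' ?_ (by positivity) |>.2
  rw [Complex.sq_norm, Complex.normSq_apply]
  have h1 := sq_le_sq' (abs_le.1 hre).1 (abs_le.1 hre).2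
  have h2 := sq_le_sq' (abs_le.1 him).1 (abs_le.1 him).2
  nlinarith [sq_nonneg δ]

/-- The second-order approximation `1 - y² + iy` of `exp (iy)` lies in the unit disc when
`|y| ≤ 1`. -/
lemma norm_one_sub_sq_add_mul_I_le_one {y : ℝ} (hy : |y| ≤ 1) :
    ‖1 - (y : ℂ) ^ 2 + y * Complex.I‖ ≤ 1 := by
  refine abs_le_of_sq_le_sq' ?_ zero_le_one |>.2
  have h : 1 - (y : ℂ) ^ 2 + y * Complex.I = ((1 - y ^ 2 : ℝ) : ℂ) + (y : ℝ) * Complex.I := by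
    push_cast; ring
  rw [h, Complex.sq_norm, Complex.normSq_add_mul_I]
  have h2 : y ^ 2 ≤ 1 := (sq_le_one_iff_abs_le_one y).2 hy
  nlinarith [sq_nonneg y]

/-- The map `y ↦ 1 - y² + iy` is Lipschitz with constant `1 + |y + z|` between `y` and `z`. -/
lemma norm_one_sub_sq_add_mul_I_sub_le (y z : ℝ) :
    ‖(1 - (y : ℂ) ^ 2 + y * Complex.I) - (1 - (z : ℂ) ^ 2 + z * Complex.I)‖
      ≤ |y - z| * (1 + |y + z|) := by
  have h : (1 - (y : ℂ) ^ 2 + y * Complex.I) - (1 - (z : ℂ) ^ 2 + z * Complex.I)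
      = ((y - z : ℝ) : ℂ) * (Complex.I - ((y + z : ℝ) : ℂ)) := by
    push_cast; ring
  rw [h, norm_mul, Complex.norm_real, Real.norm_eq_abs]
  gcongr
  refine (norm_sub_le _ _).trans ?_
  rw [Complex.norm_I, Complex.norm_real, Real.norm_eq_abs]

/-- Error propagation for perturbed repeated squaring inside the unit disc: each squaring doubles
the error accumulated so far and adds at most `ε`. -/
lemma norm_pow_two_pow_sub_le {w : ℂ} (hw : ‖w‖ ≤ 1) {u : ℕ → ℂ} {n : ℕ} {ε : ℝ}
    (hu0 : ‖u 0‖ ≤ 1) (hnorm : ∀ j < n, ‖u (j + 1)‖ ≤ ‖u j‖ ^ 2)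
    (hstep : ∀ j < n, ‖u (j + 1) - u j ^ 2‖ ≤ ε) :
    ‖w ^ 2 ^ n - u n‖ ≤ 2 ^ n * (‖w - u 0‖ + ε) - ε := by
  suffices h : ∀ j ≤ n, ‖u j‖ ≤ 1 ∧ ‖w ^ 2 ^ j - u j‖ ≤ 2 ^ j * (‖w - u 0‖ + ε) - ε from
    (h n le_rfl).2
  intro j
  induction j with
  | zero => intro _; simp [hu0]
  | succ j ih =>
    intro hj
    obtain ⟨h1, h2⟩ := ih (by omega)
    refine ⟨(hnorm j hj).trans (pow_le_one₀ (norm_nonneg _) h1), ?_⟩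
    have hsum : ‖w ^ 2 ^ j + u j‖ ≤ 2 := by
      refine (norm_add_le _ _).trans ?_
      rw [norm_pow]
      linarith [pow_le_one₀ (n := 2 ^ j) (norm_nonneg w) hw]
    have hsplit : w ^ 2 ^ (j + 1) - u (j + 1)
        = (w ^ 2 ^ j + u j) * (w ^ 2 ^ j - u j) - (u (j + 1) - u j ^ 2) := by
      rw [pow_succ 2 j, pow_mul]; ring
    calc ‖w ^ 2 ^ (j + 1) - u (j + 1)‖
        ≤ ‖w ^ 2 ^ j + u j‖ * ‖w ^ 2 ^ j - u j‖ + ‖u (j + 1) - u j ^ 2‖ := by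
          rw [hsplit, ← norm_mul]; exact norm_sub_le _ _
      _ ≤ 2 * (2 ^ j * (‖w - u 0‖ + ε) - ε) + ε := by
          gcongr
          exact hstep j hj
      _ = 2 ^ (j + 1) * (‖w - u 0‖ + ε) - ε := by ring

/-- Fixed-precision repeated squaring: with `ν ≥ 1`, `m ≥ 1`, `M = 2^m`,
`r = 2^{ν+7}`, `s ≥ 11 + ν + m`, `π/(2M) ≤ x < π/2`, `y = x/r`,
`W = 1 - y² + iy`, `ŷ` an `s`-bit truncation of `y` (`0 ≤ y - ŷ ≤ 2^{-s}`),
`Ŵ₁ = Wh 0` a truncation of `1 - ŷ² + iŷ`, and each `Ŵ_{2^{j+1}} = Wh (j+1)`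
obtained from squaring `Wh j` with truncation (real and imaginary parts change
by at most `2^{-s}` and the modulus does not increase), the final result
satisfies `|W^r - Ŵ_r| ≤ 2^{ν+9}/2^s`, where `Ŵ_r = Wh (ν+7)`. -/
theorem repeated_squaring_fixed_precision_error
    (ν m : ℕ) (hν : 1 ≤ ν) (hm : 1 ≤ m) (s : ℕ) (hs : 11 + ν + m ≤ s)
    (x : ℝ) (hx1 : π / (2 * 2^m) ≤ x) (hx2 : x < π / 2)
    (yh : ℝ) (hy1 : 0 ≤ x / 2^(ν+7) - yh)
    (hy2 : x / 2^(ν+7) - yh ≤ (2:ℝ)^(-(s:ℤ)))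
    (Wh : ℕ → ℂ)
    (h0re : |(Wh 0 - (1 - (yh:ℂ)^2 + yh * Complex.I)).re| ≤ (2:ℝ)^(-(s:ℤ)))
    (h0im : |(Wh 0 - (1 - (yh:ℂ)^2 + yh * Complex.I)).im| ≤ (2:ℝ)^(-(s:ℤ)))
    (h0norm : ‖Wh 0‖ ≤ ‖1 - (yh:ℂ)^2 + yh * Complex.I‖)
    (hstepre : ∀ j < ν + 7, |(Wh (j+1) - (Wh j)^2).re| ≤ (2:ℝ)^(-(s:ℤ)))
    (hstepim : ∀ j < ν + 7, |(Wh (j+1) - (Wh j)^2).im| ≤ (2:ℝ)^(-(s:ℤ)))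
    (hstepnorm : ∀ j < ν + 7, ‖Wh (j+1)‖ ≤ ‖Wh j‖^2) :
    ‖(1 - ((x / 2^(ν+7) : ℝ) : ℂ)^2 + (x / 2^(ν+7) : ℝ) * Complex.I)^(2^(ν+7))
        - Wh (ν+7)‖ ≤ 2^(ν+9) / 2^s := by
  set y : ℝ := x / 2 ^ (ν + 7) with hy
  set δ : ℝ := (2 : ℝ) ^ (-(s : ℤ)) with hδ
  have hδ0 : 0 < δ := by positivity
  have hx0 : 0 < x := lt_of_lt_of_le (by positivity) hx1
  have hy0 : 0 < y := by positivity
  have hy_small : y ≤ 0.02 := by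
    have h256 : (2 : ℝ) ^ 7 ≤ 2 ^ (ν + 7) := pow_le_pow_right₀ one_le_two (by omega)
    rw [hy, div_le_iff₀ (by positivity)]
    nlinarith [Real.pi_lt_four]
  have hδy : δ ≤ y := by
    rw [hy, le_div_iff₀ (by positivity)]
    refine le_trans ?_ hx1
    rw [le_div_iff₀ (by positivity), hδ, zpow_neg, zpow_natCast, mul_assoc,
      inv_mul_le_iff₀ (by positivity)]
    have h2s : (2 : ℝ) ^ (ν + 7) * (2 * 2 ^ m) ≤ 2 ^ s := by
      rw [← pow_succ', ← pow_add]
      exact pow_le_pow_right₀ one_le_two (by omega)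
    nlinarith [Real.pi_gt_three, pow_pos (two_pos (α := ℝ)) s]
  have hyh0 : 0 ≤ yh := by linarith
  have hW : ‖1 - (y : ℂ) ^ 2 + y * Complex.I‖ ≤ 1 :=
    norm_one_sub_sq_add_mul_I_le_one (by rw [abs_of_pos hy0]; linarith)
  have hWh0 : ‖Wh 0‖ ≤ 1 :=
    h0norm.trans (norm_one_sub_sq_add_mul_I_le_one (by rw [abs_of_nonneg hyh0]; linarith))
  have herr : ‖1 - (y : ℂ) ^ 2 + y * Complex.I - Wh 0‖ ≤ 2.5 * δ := by
    have h1 := norm_one_sub_sq_add_mul_I_sub_le y yh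
    rw [abs_of_nonneg hy1, abs_of_nonneg (by linarith : 0 ≤ y + yh)] at h1
    have h2 := Complex.norm_le_of_abs_re_le_of_abs_im_le h0re h0im
    rw [norm_sub_rev] at h2
    have h3 : (y - yh) * (1 + (y + yh)) ≤ δ * 1.04 := by
      gcongr
      linarith
    linarith [norm_sub_le_norm_sub_add_norm_sub (1 - (y : ℂ) ^ 2 + y * Complex.I)
      (1 - (yh : ℂ) ^ 2 + yh * Complex.I) (Wh 0)]
  calc _ ≤ 2 ^ (ν + 7) * (‖1 - (y : ℂ) ^ 2 + y * Complex.I - Wh 0‖ + 1.42 * δ) - 1.42 * δ :=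
        norm_pow_two_pow_sub_le hW hWh0 hstepnorm fun j hj ↦
          Complex.norm_le_of_abs_re_le_of_abs_im_le (hstepre j hj) (hstepim j hj)
    _ ≤ 2 ^ (ν + 7) * (4 * δ) := by
        refine (sub_le_self _ (by positivity)).trans ?_
        gcongr
        linarith
    _ = 2 ^ (ν + 9) / 2 ^ s := by
        rw [hδ, zpow_neg, zpow_natCast]; ring
end
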